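/- arXiv:1805.06929 — 3 statements merged into one kernel-verified Lean document; each statement's English description precedes it below -/
import Mathlib

section
/- Let α, ν, β > 0, κ ∈ (0,1) with κ(α/ν − 1) < 1 and ν/κ + (ν − α) > 1, and let f be the κGG density with mean m. Then the Theil index T = ∫₀^∞ (x/m)·ln(x/m)·f(x) dx equals (1/ν)·[ ψ((α+1)/ν) − (1/2)ψ(1/(2κ) − (α+1−ν)/(2ν)) − (1/2)ψ(1/(2κ) + (α+1−ν)/(2ν)) − ln(2κ) + ν·ln(β/m) − κν/(ν + κ(α+1−ν)) ], where ψ(z) = Γ'(z)/Γ(z) is the digamma function. -/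
open Real MeasureTheory Filter Set

/-- The κ-deformed exponential of Kaniadakis. -/
noncomputable def kexp (κ x : ℝ) : ℝ := (Real.sqrt (1 + κ^2 * x^2) + κ * x) ^ (1/κ)

/-- The κ-deformed logarithm of Kaniadakis. -/
noncomputable def klog (κ x : ℝ) : ℝ := (x ^ κ - x ^ (-κ)) / (2*κ)

/-- The κ-deformed Gamma function (closed form in terms of the Euler Gamma function). -/
noncomputable def kGamma (κ z : ℝ) : ℝ :=
  ((1 - κ*(z-1)) / (2*κ) ^ (z-1)) *
    (Real.Gamma (1/(2*κ) - (z-1)/2) / Real.Gamma (1/(2*κ) + (z-1)/2)) * Real.Gamma z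

/-- The κ-Generalized Gamma (κGG) density. -/
noncomputable def kGG (α ν β κ x : ℝ) : ℝ :=
  (1 - κ^2*(α/ν - 1)^2) * (ν/β) * (kGamma κ (α/ν))⁻¹ * (x/β) ^ (α-1) *
    kexp κ (-((x/β) ^ ν)) / Real.sqrt (1 + κ^2 * (x/β) ^ (2*ν))

/-- The digamma function ψ = Γ'/Γ. -/
noncomputable def digamma (z : ℝ) : ℝ := deriv Real.Gamma z / Real.Gamma z


open scoped Topology

/-- The function whose Mellin transform gives the moments of the κGG distribution. -/
noncomputable def kkernel (κ t : ℝ) : ℝ := kexp κ (-t) / √(1 + κ ^ 2 * t ^ 2)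

lemma integral_Ioo_rpow_mul_one_sub_rpow {a b : ℝ} (ha : 0 < a) (hb : 0 < b) :
    ∫ w in Ioo (0 : ℝ) 1, w ^ (a - 1) * (1 - w) ^ (b - 1) = ProbabilityTheory.beta a b := by
  rw [ProbabilityTheory.beta_eq_betaIntegralReal a b ha hb, Complex.betaIntegral,
    intervalIntegral.integral_of_le zero_le_one, ← integral_Ioc_eq_integral_Ioo,
    ← RCLike.re_to_complex, ← integral_re]
  · refine setIntegral_congr_fun measurableSet_Ioc fun w hw => ?_
    norm_cast
    rw [← Complex.ofReal_cpow hw.1.le, ← Complex.ofReal_cpow (by linarith [hw.2]),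
      RCLike.re_to_complex, ← Complex.ofReal_mul, Complex.ofReal_re]
  · rw [← IntegrableOn, ← intervalIntegrable_iff_integrableOn_Ioc_of_le zero_le_one]
    exact Complex.betaIntegral_convergent (by simpa) (by simpa)

lemma sqrt_one_add_sq_sub_pos (u : ℝ) : 0 < √(1 + u ^ 2) - u := by
  have : |u| < √(1 + u ^ 2) := by
    rw [← Real.sqrt_sq_eq_abs]
    exact Real.sqrt_lt_sqrt (sq_nonneg u) (by linarith)
  linarith [le_abs_self u]

lemma kexp_neg (κ t : ℝ) : kexp κ (-t) = (√(1 + (κ * t) ^ 2) - κ * t) ^ (1 / κ) := by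
  simp only [kexp, neg_sq, mul_pow, mul_neg, ← sub_eq_add_neg]

lemma sqrt_one_add_sq_kaniadakis {κ w : ℝ} (hκ : 0 < κ) (hw : 0 < w) :
    √(1 + (κ * ((1 - w) / (2 * κ * √w))) ^ 2) = (1 + w) / (2 * √w) := by
  have hs : 0 < √w := Real.sqrt_pos.2 hw
  have h2 : √w ^ 2 = w := Real.sq_sqrt hw.le
  rw [Real.sqrt_eq_iff_mul_self_eq (by positivity) (by positivity)]
  field_simp
  rw [h2]
  ring

lemma sqrt_sub_kaniadakis {κ w : ℝ} (hκ : 0 < κ) (hw : 0 < w) :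
    √(1 + (κ * ((1 - w) / (2 * κ * √w))) ^ 2) - κ * ((1 - w) / (2 * κ * √w)) = √w := by
  have hs : 0 < √w := Real.sqrt_pos.2 hw
  have h2 : √w ^ 2 = w := Real.sq_sqrt hw.le
  rw [sqrt_one_add_sq_kaniadakis hκ hw]
  field_simp
  rw [h2]
  ring

lemma hasDerivAt_kaniadakis {κ w : ℝ} (hκ : 0 < κ) (hw : 0 < w) :
    HasDerivAt (fun w => (1 - w) / (2 * κ * √w)) (-((1 + w) / (4 * κ * w * √w))) w := by
  have hs : 0 < √w := Real.sqrt_pos.2 hw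
  have h2 : √w ^ 2 = w := Real.sq_sqrt hw.le
  have := ((hasDerivAt_id w).const_sub 1).div
    ((Real.hasDerivAt_sqrt hw.ne').const_mul (2 * κ)) (by positivity)
  refine this.congr_deriv ?_
  simp only [id]
  field_simp
  rw [h2]
  ring

lemma image_kaniadakis {κ : ℝ} (hκ : 0 < κ) :
    (fun w => (1 - w) / (2 * κ * √w)) '' Ioo 0 1 = Ioi 0 := by
  ext t
  constructor
  · rintro ⟨w, ⟨h0, h1⟩, rfl⟩
    have hs : 0 < √w := Real.sqrt_pos.2 h0
    have hw1 : 0 < 1 - w := by linarith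
    exact div_pos hw1 (by positivity)
  · intro (ht : 0 < t)
    have hy := sqrt_one_add_sq_sub_pos (κ * t)
    have hS : √(1 + (κ * t) ^ 2) ^ 2 = 1 + (κ * t) ^ 2 := Real.sq_sqrt (by positivity)
    have hκt : 0 < κ * t := by positivity
    have hy1 : √(1 + (κ * t) ^ 2) - κ * t < 1 := by
      have : √(1 + (κ * t) ^ 2) < 1 + κ * t := by
        rw [Real.sqrt_lt' (by positivity)]
        nlinarith
      linarith
    refine ⟨(√(1 + (κ * t) ^ 2) - κ * t) ^ 2, ⟨by positivity, by nlinarith⟩, ?_⟩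
    simp only
    rw [Real.sqrt_sq hy.le, div_eq_iff (by positivity)]
    nlinarith

lemma injOn_kaniadakis {κ : ℝ} (hκ : 0 < κ) :
    InjOn (fun w => (1 - w) / (2 * κ * √w)) (Ioo 0 1) := by
  intro w hw v hv (hwv : (1 - w) / (2 * κ * √w) = (1 - v) / (2 * κ * √v))
  have h1 := sqrt_sub_kaniadakis hκ hw.1
  rw [hwv, sqrt_sub_kaniadakis hκ hv.1] at h1
  exact ((Real.sqrt_inj hv.1.le hw.1.le).1 h1).symm

/-- The Mellin transform of `kkernel κ` as a beta function. -/
lemma integral_rpow_mul_kkernel_eq_beta {κ z : ℝ} (hκ : 0 < κ) (hz : 0 < z)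
    (h : κ * (z - 1) < 1) :
    ∫ t in Ioi (0 : ℝ), t ^ (z - 1) * kkernel κ t =
      (2 * κ) ^ (-z) * ProbabilityTheory.beta (1 / (2 * κ) - (z - 1) / 2) z := by
  have ha : 0 < 1 / (2 * κ) - (z - 1) / 2 := by
    have : 1 / (2 * κ) - (z - 1) / 2 = (1 - κ * (z - 1)) / (2 * κ) := by field_simp
    rw [this]
    exact div_pos (by linarith) (by positivity)
  rw [← integral_Ioo_rpow_mul_one_sub_rpow ha hz, ← image_kaniadakis hκ,
    integral_image_eq_integral_abs_deriv_smul measurableSet_Ioo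
      (fun w hw => (hasDerivAt_kaniadakis hκ hw.1).hasDerivWithinAt) (injOn_kaniadakis hκ),
    ← integral_const_mul]
  refine setIntegral_congr_fun measurableSet_Ioo fun w ⟨h0, h1⟩ => ?_
  have hs : 0 < √w := Real.sqrt_pos.2 h0
  have hw1 : 0 < 1 - w := by linarith
  have e1 : √w ^ (1 / κ) = w ^ (1 / (2 * κ)) := by
    rw [Real.sqrt_eq_rpow, ← Real.rpow_mul h0.le]
    congr 1
    field_simp
  have e2 : √w ^ (z - 1) = w ^ ((z - 1) / 2) := by
    rw [Real.sqrt_eq_rpow, ← Real.rpow_mul h0.le]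
    congr 1
    ring
  have e3 : (2 * κ) ^ (-z) = ((2 * κ) ^ (z - 1))⁻¹ * (2 * κ)⁻¹ := by
    rw [← Real.rpow_neg (by positivity), ← Real.rpow_neg_one (2 * κ),
      ← Real.rpow_add (by positivity)]
    congr 1
    ring
  simp only [kkernel, kexp_neg, ← mul_pow, smul_eq_mul]
  rw [sqrt_sub_kaniadakis hκ h0, sqrt_one_add_sq_kaniadakis hκ h0, abs_neg,
    abs_of_pos (by positivity), Real.div_rpow hw1.le (by positivity),
    Real.mul_rpow (by positivity) hs.le, e1, e2, e3, Real.rpow_sub h0, Real.rpow_sub h0,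
    Real.rpow_one]
  have : w ^ ((z - 1) / 2) ≠ 0 := (Real.rpow_pos_of_pos h0 _).ne'
  have : (2 * κ) ^ (z - 1) ≠ 0 := (Real.rpow_pos_of_pos (by positivity) _).ne'
  field_simp
  norm_num

/-- The Mellin transform of `kkernel κ`, in closed form. -/
lemma integral_rpow_mul_kkernel {κ z : ℝ} (hκ : κ ∈ Ioo (0 : ℝ) 1) (hz : 0 < z)
    (h : κ * (z - 1) < 1) :
    ∫ t in Ioi (0 : ℝ), t ^ (z - 1) * kkernel κ t =
      (2 * κ) ^ (1 - z) * Real.Gamma (1 / (2 * κ) - (z - 1) / 2) * Real.Gamma z /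
        (Real.Gamma (1 / (2 * κ) + (z - 1) / 2) * (1 + κ * (z - 1))) := by
  obtain ⟨hκ0, hκ1⟩ := hκ
  have hz1 : 0 < 1 + κ * (z - 1) := by nlinarith
  have hb : 1 / (2 * κ) + (z - 1) / 2 = (1 + κ * (z - 1)) / (2 * κ) := by field_simp
  have hb0 : 0 < 1 / (2 * κ) + (z - 1) / 2 := hb ▸ by positivity
  have hG := (Real.Gamma_pos_of_pos hb0).ne'
  rw [integral_rpow_mul_kkernel_eq_beta hκ0 hz h, ProbabilityTheory.beta,
    show 1 / (2 * κ) - (z - 1) / 2 + z = 1 / (2 * κ) + (z - 1) / 2 + 1 by ring,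
    Real.Gamma_add_one hb0.ne', show 1 - z = -z + 1 by ring,
    Real.rpow_add_one (by positivity)]
  set G := Real.Gamma (1 / (2 * κ) + (z - 1) / 2)
  rw [hb]
  field_simp

lemma continuous_kkernel {κ : ℝ} : Continuous (kkernel κ) := by
  have h1 : Continuous fun t : ℝ => (√(1 + (κ * t) ^ 2) - κ * t) ^ (1 / κ) :=
    Continuous.rpow_const (by fun_prop) fun t => Or.inl (sqrt_one_add_sq_sub_pos _).ne'
  have h2 : kkernel κ = fun t => (√(1 + (κ * t) ^ 2) - κ * t) ^ (1 / κ) /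
      √(1 + κ ^ 2 * t ^ 2) := by
    ext t
    rw [kkernel, kexp_neg]
  rw [h2]
  exact h1.div (by fun_prop) fun t => (Real.sqrt_pos.2 (by positivity)).ne'

lemma kkernel_nonneg (κ t : ℝ) : 0 ≤ kkernel κ t := by
  rw [kkernel, kexp_neg]
  exact div_nonneg (Real.rpow_nonneg (sqrt_one_add_sq_sub_pos _).le _) (Real.sqrt_nonneg _)

lemma kkernel_le {κ t : ℝ} (hκ : 0 < κ) (ht : 0 < t) :
    kkernel κ t ≤ (κ * t) ^ (-(1 / κ + 1)) := by
  have hκt : 0 < κ * t := by positivity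
  have hpos := sqrt_one_add_sq_sub_pos (κ * t)
  have hS : √(1 + (κ * t) ^ 2) ^ 2 = 1 + (κ * t) ^ 2 := Real.sq_sqrt (by positivity)
  have h1 : √(1 + (κ * t) ^ 2) - κ * t ≤ (κ * t)⁻¹ := by
    rw [← one_div, le_div_iff₀ hκt]
    nlinarith
  rw [kkernel, kexp_neg, ← mul_pow, neg_add, Real.rpow_add hκt, Real.rpow_neg_one,
    Real.rpow_neg hκt.le, ← Real.inv_rpow hκt.le, div_eq_mul_inv]
  gcongr
  linarith

lemma hasDerivAt_mellin_kkernel {κ z : ℝ} (hκ : 0 < κ) (hz : 0 < z) (h : κ * (z - 1) < 1) :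
    MellinConvergent (fun t => (kkernel κ t : ℂ)) z ∧
    MellinConvergent (fun t => Real.log t • (kkernel κ t : ℂ)) z ∧
      HasDerivAt (mellin fun t => (kkernel κ t : ℂ))
        (mellin (fun t => Real.log t • (kkernel κ t : ℂ)) z) z := by
  have hc : Continuous fun t => (kkernel κ t : ℂ) :=
    Complex.continuous_ofReal.comp continuous_kkernel
  have hl : LocallyIntegrableOn (fun t => (kkernel κ t : ℂ)) (Ioi 0) :=
    hc.locallyIntegrable.locallyIntegrableOn _
  have htop : (fun t => (kkernel κ t : ℂ)) =O[atTop] fun t : ℝ => t ^ (-(1 / κ + 1)) := by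
    refine Asymptotics.IsBigO.of_bound (κ ^ (-(1 / κ + 1))) ?_
    filter_upwards [eventually_gt_atTop 0] with t ht
    rw [Complex.norm_real, Real.norm_of_nonneg (kkernel_nonneg κ t),
      Real.norm_of_nonneg (by positivity), ← Real.mul_rpow hκ.le ht.le]
    exact kkernel_le hκ ht
  have hbot : (fun t => (kkernel κ t : ℂ)) =O[𝓝[>] 0] fun t : ℝ => t ^ (-(0 : ℝ)) := by
    simp only [neg_zero, Real.rpow_zero]
    exact (hc.tendsto 0).isBigO_one ℝ |>.mono nhdsWithin_le_nhds
  have hs : (z : ℂ).re < 1 / κ + 1 := by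
    have : z - 1 < 1 / κ := by rw [lt_div_iff₀ hκ]; linarith
    simp only [Complex.ofReal_re]
    linarith
  exact ⟨mellinConvergent_of_isBigO_rpow hl htop hs hbot hz,
    mellin_hasDerivAt_of_isBigO_rpow hl htop hs hbot hz⟩

lemma ofReal_cpow_smul_ofReal {z t : ℝ} (ht : 0 < t) (c : ℝ) :
    (t : ℂ) ^ ((z : ℂ) - 1) • (c : ℂ) = ((t ^ (z - 1) * c : ℝ) : ℂ) := by
  rw [smul_eq_mul, Complex.ofReal_mul, Complex.ofReal_cpow ht.le]
  push_cast
  rfl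

lemma mellin_ofReal (g : ℝ → ℝ) (z : ℝ) :
    mellin (fun t => (g t : ℂ)) z = ((∫ t in Ioi (0 : ℝ), t ^ (z - 1) * g t : ℝ) : ℂ) := by
  rw [mellin, ← integral_complex_ofReal]
  exact setIntegral_congr_fun measurableSet_Ioi fun t ht => ofReal_cpow_smul_ofReal ht _

lemma MellinConvergent.integrableOn_ofReal {g : ℝ → ℝ} {z : ℝ}
    (hg : MellinConvergent (fun t => (g t : ℂ)) z) :
    IntegrableOn (fun t => t ^ (z - 1) * g t) (Ioi 0) := by
  have h : IntegrableOn (fun t => ((t ^ (z - 1) * g t : ℝ) : ℂ)) (Ioi 0) :=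
    IntegrableOn.congr_fun hg (fun t ht => ofReal_cpow_smul_ofReal ht _) measurableSet_Ioi
  exact h.re

lemma integrableOn_rpow_mul_kkernel {κ z : ℝ} (hκ : 0 < κ) (hz : 0 < z) (h : κ * (z - 1) < 1) :
    IntegrableOn (fun t => t ^ (z - 1) * kkernel κ t) (Ioi 0) :=
  (hasDerivAt_mellin_kkernel hκ hz h).1.integrableOn_ofReal

lemma integrableOn_rpow_mul_log_mul_kkernel {κ z : ℝ} (hκ : 0 < κ) (hz : 0 < z)
    (h : κ * (z - 1) < 1) :
    IntegrableOn (fun t => t ^ (z - 1) * (Real.log t * kkernel κ t)) (Ioi 0) := by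
  have := (hasDerivAt_mellin_kkernel hκ hz h).2.1
  simp only [Complex.real_smul, ← Complex.ofReal_mul] at this
  exact this.integrableOn_ofReal

lemma hasDerivAt_integral_rpow_mul_kkernel {κ z : ℝ} (hκ : 0 < κ) (hz : 0 < z)
    (h : κ * (z - 1) < 1) :
    HasDerivAt (fun z : ℝ => ∫ t in Ioi (0 : ℝ), t ^ (z - 1) * kkernel κ t)
      (∫ t in Ioi (0 : ℝ), t ^ (z - 1) * (Real.log t * kkernel κ t)) z := by
  have := (hasDerivAt_mellin_kkernel hκ hz h).2.2.real_of_complex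
  simp only [Complex.real_smul, ← Complex.ofReal_mul] at this
  simpa only [mellin_ofReal, Complex.ofReal_re] using this

lemma hasDerivAt_Gamma_digamma {z : ℝ} (hz : 0 < z) :
    HasDerivAt Real.Gamma (Real.Gamma z * digamma z) z := by
  have hd : DifferentiableAt ℝ Real.Gamma z :=
    Real.differentiableAt_Gamma fun m => by have := m.cast_nonneg (α := ℝ); linarith
  rw [digamma, mul_div_cancel₀ _ (Real.Gamma_pos_of_pos hz).ne']
  exact hd.hasDerivAt

/-- The logarithmic derivative of the Mellin transform of `kkernel κ`. -/
lemma integral_rpow_mul_log_mul_kkernel {κ z : ℝ} (hκ : κ ∈ Ioo (0 : ℝ) 1) (hz : 0 < z)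
    (h : κ * (z - 1) < 1) :
    ∫ t in Ioi (0 : ℝ), t ^ (z - 1) * (Real.log t * kkernel κ t) =
      (∫ t in Ioi (0 : ℝ), t ^ (z - 1) * kkernel κ t) *
        (digamma z - 1 / 2 * digamma (1 / (2 * κ) - (z - 1) / 2)
          - 1 / 2 * digamma (1 / (2 * κ) + (z - 1) / 2) - Real.log (2 * κ)
          - κ / (1 + κ * (z - 1))) := by
  have hκ0 := hκ.1
  have hκ1 := hκ.2
  have hz1 : 0 < 1 + κ * (z - 1) := by nlinarith
  have ha0 : 0 < 1 / (2 * κ) - (z - 1) / 2 := by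
    have : 1 / (2 * κ) - (z - 1) / 2 = (1 - κ * (z - 1)) / (2 * κ) := by field_simp
    rw [this]
    exact div_pos (by linarith) (by positivity)
  have hb0 : 0 < 1 / (2 * κ) + (z - 1) / 2 := by
    have : 1 / (2 * κ) + (z - 1) / 2 = (1 + κ * (z - 1)) / (2 * κ) := by field_simp
    rw [this]
    positivity
  have hd := hasDerivAt_integral_rpow_mul_kkernel hκ0 hz h
  have hev : (fun z : ℝ => ∫ t in Ioi (0 : ℝ), t ^ (z - 1) * kkernel κ t) =ᶠ[𝓝 z]
      fun z => (2 * κ) ^ (1 - z) * Real.Gamma (1 / (2 * κ) - (z - 1) / 2) * Real.Gamma z /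
        (Real.Gamma (1 / (2 * κ) + (z - 1) / 2) * (1 + κ * (z - 1))) := by
    have hc : ContinuousAt (fun z => κ * (z - 1)) z := by fun_prop
    filter_upwards [lt_mem_nhds hz, hc.eventually_lt_const h] with y hy0 hy
    exact integral_rpow_mul_kkernel hκ hy0 hy
  have hlin : HasDerivAt (fun z : ℝ => (z - 1) / 2) (1 / 2) z :=
    ((hasDerivAt_id z).sub_const 1).div_const 2
  have hGa := (hasDerivAt_Gamma_digamma ha0).comp z (hlin.const_sub (1 / (2 * κ)))
  have hGb := (hasDerivAt_Gamma_digamma hb0).comp z (hlin.const_add (1 / (2 * κ)))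
  have hP : HasDerivAt (fun z : ℝ => (2 * κ) ^ (1 - z))
      (Real.log (2 * κ) * -1 * (2 * κ) ^ (1 - z)) z :=
    ((hasDerivAt_id z).const_sub 1).const_rpow (by positivity)
  have hL : HasDerivAt (fun z : ℝ => 1 + κ * (z - 1)) (κ * 1) z :=
    (((hasDerivAt_id z).sub_const 1).const_mul κ).const_add 1
  have hGb' := (Real.Gamma_pos_of_pos hb0).ne'
  have hcl := ((hP.mul hGa).mul (hasDerivAt_Gamma_digamma hz)).div (hGb.mul hL)
    (mul_ne_zero hGb' hz1.ne')
  rw [hd.unique (hcl.congr_of_eventuallyEq hev), integral_rpow_mul_kkernel hκ hz h]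
  simp only [Function.comp_apply, Pi.mul_apply]
  field_simp
  ring

/-- Rewriting an expectation against the κGG density, weighted by `x`, in terms of
`kkernel κ`. -/
lemma integral_mul_mul_kGG {α ν β : ℝ} (κ : ℝ) (hν : 0 < ν) (hβ : 0 < β) (φ : ℝ → ℝ) :
    ∫ x in Ioi (0 : ℝ), x * φ x * kGG α ν β κ x =
      (1 - κ ^ 2 * (α / ν - 1) ^ 2) * (kGamma κ (α / ν))⁻¹ * β *
        ∫ t in Ioi (0 : ℝ), φ (β * t ^ (1 / ν)) * (t ^ ((α + 1) / ν - 1) * kkernel κ t) := by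
  have h1 := integral_comp_mul_left_Ioi' (fun x => x * φ x * kGG α ν β κ x) 0 hβ
  rw [mul_zero] at h1
  rw [← h1, ← integral_comp_rpow_Ioi_of_pos
    (g := fun t => φ (β * t ^ (1 / ν)) * (t ^ ((α + 1) / ν - 1) * kkernel κ t)) hν, smul_eq_mul, ← integral_const_mul,
    ← integral_const_mul]
  refine setIntegral_congr_fun measurableSet_Ioi fun y (hy : 0 < y) => ?_
  have e1 : (y ^ ν) ^ (1 / ν) = y := by
    rw [← Real.rpow_mul hy.le, mul_one_div_cancel hν.ne', Real.rpow_one]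
  have e2 : (y ^ ν) ^ ((α + 1) / ν - 1) = y ^ (α - 1) * y * y / y ^ ν := by
    rw [← Real.rpow_add_one hy.ne', ← Real.rpow_add_one hy.ne', ← Real.rpow_sub hy,
      ← Real.rpow_mul hy.le]
    congr 1
    field_simp
    ring
  have e3 : y ^ (2 * ν) = (y ^ ν) ^ 2 := by
    rw [mul_comm, Real.rpow_mul hy.le, Real.rpow_two]
  have hyν : y ^ ν ≠ 0 := (Real.rpow_pos_of_pos hy ν).ne'
  simp only [kGG, kkernel, smul_eq_mul]
  rw [mul_div_cancel_left₀ _ hβ.ne', e1, e2, e3, Real.rpow_sub_one hy.ne' ν]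
  field_simp

lemma kGamma_pos {κ z : ℝ} (hκ : κ ∈ Ioo (0 : ℝ) 1) (hz : 0 < z) (h : κ * (z - 1) < 1) :
    0 < kGamma κ z := by
  obtain ⟨hκ0, hκ1⟩ := hκ
  have ha0 : 0 < 1 - κ * (z - 1) := by linarith
  have hz1 : 0 < 1 + κ * (z - 1) := by nlinarith
  have ha : 1 / (2 * κ) - (z - 1) / 2 = (1 - κ * (z - 1)) / (2 * κ) := by field_simp
  have hb : 1 / (2 * κ) + (z - 1) / 2 = (1 + κ * (z - 1)) / (2 * κ) := by field_simp
  have hGa : 0 < Real.Gamma (1 / (2 * κ) - (z - 1) / 2) :=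
    Real.Gamma_pos_of_pos (ha ▸ by positivity)
  have hGb : 0 < Real.Gamma (1 / (2 * κ) + (z - 1) / 2) :=
    Real.Gamma_pos_of_pos (hb ▸ by positivity)
  have hG := Real.Gamma_pos_of_pos hz
  unfold kGamma
  positivity

lemma integral_rpow_mul_kkernel_pos {κ z : ℝ} (hκ : 0 < κ) (hz : 0 < z) (h : κ * (z - 1) < 1) :
    0 < ∫ t in Ioi (0 : ℝ), t ^ (z - 1) * kkernel κ t := by
  have ha : 1 / (2 * κ) - (z - 1) / 2 = (1 - κ * (z - 1)) / (2 * κ) := by field_simp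
  have ha0 : 0 < 1 - κ * (z - 1) := by linarith
  rw [integral_rpow_mul_kkernel_eq_beta hκ hz h]
  exact mul_pos (by positivity) (ProbabilityTheory.beta_pos (ha ▸ by positivity) hz)

/-- The Theil index of the κGG distribution. -/
theorem kGG_theil (α ν β κ m : ℝ) (hα : 0 < α) (hν : 0 < ν) (hβ : 0 < β)
    (hκ : κ ∈ Set.Ioo (0:ℝ) 1) (h : κ * (α/ν - 1) < 1) (hmom : 1 < ν/κ + (ν - α))
    (hm : m = ∫ x in Set.Ioi (0:ℝ), x * kGG α ν β κ x) :
    ∫ x in Set.Ioi (0:ℝ), (x/m) * Real.log (x/m) * kGG α ν β κ x =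
      (1/ν) *
        ( digamma ((α+1)/ν)
          - (1/2) * digamma (1/(2*κ) - (α+1-ν)/(2*ν))
          - (1/2) * digamma (1/(2*κ) + (α+1-ν)/(2*ν))
          - Real.log (2*κ) + ν * Real.log (β/m)
          - κ*ν/(ν + κ*(α+1-ν)) ) := by
  have hκ0 := hκ.1
  have hκ1 := hκ.2
  set z := (α + 1) / ν with hz_def
  have hz : 0 < z := by positivity
  have hαν : 0 < α / ν := by positivity
  have hzκ : κ * (z - 1) < 1 := by
    have h1 : z - 1 = (α + 1 - ν) / ν := by rw [hz_def]; field_simp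
    have h2 : α + 1 - ν < ν / κ := by linarith
    rw [lt_div_iff₀ hκ0] at h2
    rw [h1, ← mul_div_assoc, div_lt_one hν]
    linarith
  have hν' : 0 < ν + κ * (α + 1 - ν) := by nlinarith
  set K := (1 - κ ^ 2 * (α / ν - 1) ^ 2) * (kGamma κ (α / ν))⁻¹ * β with hK_def
  have hK : 0 < K := by
    have h1 : 0 < 1 + κ * (α / ν - 1) := by nlinarith
    have h2 : 0 < 1 - κ * (α / ν - 1) := by linarith
    have h3 : 1 - κ ^ 2 * (α / ν - 1) ^ 2 = (1 + κ * (α / ν - 1)) * (1 - κ * (α / ν - 1)) := by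
      ring
    have h4 := kGamma_pos hκ hαν h
    rw [hK_def, h3]
    positivity
  set I := ∫ t in Ioi (0 : ℝ), t ^ (z - 1) * kkernel κ t with hI_def
  have hI : 0 < I := integral_rpow_mul_kkernel_pos hκ0 hz hzκ
  have hmI : m = K * I := by
    have := integral_mul_mul_kGG (α := α) κ hν hβ fun _ => 1
    simpa only [mul_one, one_mul, ← hm] using this
  have hm0 : 0 < m := hmI ▸ mul_pos hK hI
  have hT : ∫ x in Ioi (0 : ℝ), (x / m) * Real.log (x / m) * kGG α ν β κ x =
      K * ∫ t in Ioi (0 : ℝ),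
        Real.log (β * t ^ (1 / ν) / m) / m * (t ^ (z - 1) * kkernel κ t) := by
    rw [← integral_mul_mul_kGG (α := α) κ hν hβ fun x => Real.log (x / m) / m]
    refine integral_congr_ae (Eventually.of_forall fun x => ?_)
    simp only
    ring
  have hsplit : ∫ t in Ioi (0 : ℝ),
        Real.log (β * t ^ (1 / ν) / m) / m * (t ^ (z - 1) * kkernel κ t) =
      1 / (ν * m) * (∫ t in Ioi (0 : ℝ), t ^ (z - 1) * (Real.log t * kkernel κ t)) +
        Real.log (β / m) / m * I := by
    rw [hI_def, ← integral_const_mul, ← integral_const_mul, ← integral_add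
      ((integrableOn_rpow_mul_log_mul_kkernel hκ0 hz hzκ).const_mul _)
      ((integrableOn_rpow_mul_kkernel hκ0 hz hzκ).const_mul _)]
    refine setIntegral_congr_fun measurableSet_Ioi fun t (ht : 0 < t) => ?_
    have htν : 0 < t ^ (1 / ν) := Real.rpow_pos_of_pos ht _
    rw [mul_div_right_comm, Real.log_mul (by positivity) htν.ne', Real.log_rpow ht]
    field_simp
    ring
  have hz2 : (α + 1 - ν) / (2 * ν) = (z - 1) / 2 := by rw [hz_def]; field_simp
  have hz3 : κ * ν / (ν + κ * (α + 1 - ν)) = κ / (1 + κ * (z - 1)) := by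
    have : 1 + κ * (z - 1) = (ν + κ * (α + 1 - ν)) / ν := by rw [hz_def]; field_simp
    rw [this, div_div_eq_mul_div]
  rw [hT, hsplit, integral_rpow_mul_log_mul_kkernel hκ hz hzκ, ← hI_def, hz2, hz3]
  generalize digamma z - 1 / 2 * digamma (1 / (2 * κ) - (z - 1) / 2)
    - 1 / 2 * digamma (1 / (2 * κ) + (z - 1) / 2) - Real.log (2 * κ) = D
  generalize κ / (1 + κ * (z - 1)) = E
  generalize Real.log (β / m) = L
  rw [hmI]
  field_simp
  ring
end

section
/- Let α, ν, β > 0 be fixed and, for κ ∈ (0,1) small enough that κ(α/ν − 1) < 1, let f_κ denote the κGG density with parameters (α, ν, β, κ). Then for every x > 0, lim_{κ→0⁺} f_κ(x) = (ν/β)·Γ(α/ν)^{−1}·(x/β)^{α−1}·exp(−(x/β)^ν), the Generalized Gamma density; i.e. the κGG distribution reduces to the three-parameter Generalized Gamma distribution in the limit κ → 0. -/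
open Real MeasureTheory Filter Set

/-- The quotient `Γ(t + s) / (Γ(t) t ^ s)`, which tends to `1` as `t → ∞`. -/
noncomputable def gammaShiftRatio (s t : ℝ) : ℝ :=
  Real.Gamma (t + s) / (Real.Gamma t * t ^ s)

theorem gammaShiftRatio_le_one {s t : ℝ} (hs : 0 < s) (hs1 : s < 1) (ht : 0 < t) :
    gammaShiftRatio s t ≤ 1 := by
  have hG := Real.Gamma_pos_of_pos ht
  rw [gammaShiftRatio, div_le_one (by positivity)]
  have h := Real.Gamma_mul_add_mul_le_rpow_Gamma_mul_rpow_Gamma ht (by linarith : 0 < t + 1)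
    (sub_pos.2 hs1) hs (by ring)
  rw [show (1 - s) * t + s * (t + 1) = t + s by ring, Real.Gamma_add_one ht.ne',
    Real.mul_rpow ht.le hG.le, mul_left_comm, ← Real.rpow_add hG, sub_add_cancel,
    Real.rpow_one] at h
  linarith

theorem le_gammaShiftRatio {s t : ℝ} (hs : 0 < s) (hs1 : s < 1) (ht : 0 < t) :
    (t / (t + s)) ^ (1 - s) ≤ gammaShiftRatio s t := by
  have hts : 0 < t + s := by linarith
  have hG := Real.Gamma_pos_of_pos ht
  have hG' := Real.Gamma_pos_of_pos hts
  have h := Real.Gamma_mul_add_mul_le_rpow_Gamma_mul_rpow_Gamma hts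
    (by linarith : 0 < t + s + 1) hs (sub_pos.2 hs1) (by ring)
  rw [show s * (t + s) + (1 - s) * (t + s + 1) = t + 1 by ring, Real.Gamma_add_one ht.ne',
    Real.Gamma_add_one hts.ne', Real.mul_rpow hts.le hG'.le, mul_left_comm,
    ← Real.rpow_add hG', add_sub_cancel, Real.rpow_one] at h
  rw [gammaShiftRatio, Real.div_rpow ht.le hts.le, div_le_div_iff₀ (by positivity) (by positivity),
    mul_left_comm, ← Real.rpow_add ht, sub_add_cancel, Real.rpow_one]
  linarith

theorem tendsto_div_add_const_atTop (s : ℝ) :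
    Tendsto (fun t : ℝ => t / (t + s)) atTop (nhds 1) := by
  have h : Tendsto (fun t : ℝ => 1 - s / (t + s)) atTop (nhds (1 - 0)) :=
    tendsto_const_nhds.sub ((tendsto_atTop_add_const_right _ s tendsto_id).const_div_atTop s)
  rw [sub_zero] at h
  refine h.congr' ?_
  filter_upwards [eventually_gt_atTop (-s)] with t ht
  have : t + s ≠ 0 := by linarith
  field_simp
  ring

theorem tendsto_gammaShiftRatio_of_mem_Ico {s : ℝ} (hs : 0 ≤ s) (hs1 : s < 1) :
    Tendsto (gammaShiftRatio s) atTop (nhds 1) := by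
  rcases hs.eq_or_lt with rfl | hs
  · refine tendsto_const_nhds.congr' ?_
    filter_upwards [eventually_gt_atTop 0] with t ht
    simp [gammaShiftRatio, (Real.Gamma_pos_of_pos ht).ne']
  · have hlow := (tendsto_div_add_const_atTop s).rpow_const (p := 1 - s) (.inl one_ne_zero)
    rw [Real.one_rpow] at hlow
    refine tendsto_of_tendsto_of_tendsto_of_le_of_le' hlow tendsto_const_nhds ?_ ?_
    · filter_upwards [eventually_gt_atTop 0] with t ht using le_gammaShiftRatio hs hs1 ht
    · filter_upwards [eventually_gt_atTop 0] with t ht using gammaShiftRatio_le_one hs hs1 ht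

theorem gammaShiftRatio_add_one {s t : ℝ} (ht : 0 < t) (hts : 0 < t + s) :
    gammaShiftRatio (s + 1) t = gammaShiftRatio s t / (t / (t + s)) := by
  have hG := Real.Gamma_pos_of_pos ht
  rw [gammaShiftRatio, gammaShiftRatio, ← add_assoc, Real.Gamma_add_one hts.ne',
    Real.rpow_add_one ht.ne']
  field_simp

theorem tendsto_gammaShiftRatio_add_one_iff (s : ℝ) :
    Tendsto (gammaShiftRatio (s + 1)) atTop (nhds 1) ↔
      Tendsto (gammaShiftRatio s) atTop (nhds 1) := by
  have hq := tendsto_div_add_const_atTop s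
  constructor
  · intro h
    have h' := h.mul hq
    rw [mul_one] at h'
    refine h'.congr' ?_
    filter_upwards [eventually_gt_atTop 0, eventually_gt_atTop (-s)] with t ht hts
    have hts : 0 < t + s := by linarith
    rw [gammaShiftRatio_add_one ht hts, div_mul_cancel₀ _ (by positivity)]
  · intro h
    have h' := h.div hq one_ne_zero
    rw [div_one] at h'
    refine h'.congr' ?_
    filter_upwards [eventually_gt_atTop 0, eventually_gt_atTop (-s)] with t ht hts
    exact (gammaShiftRatio_add_one ht (by linarith)).symm

/-- `Γ(t + s) ~ Γ(t) t ^ s` as `t → ∞`, for every real `s`. -/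
theorem tendsto_gammaShiftRatio (s : ℝ) : Tendsto (gammaShiftRatio s) atTop (nhds 1) := by
  have key : ∀ n : ℤ, Tendsto (gammaShiftRatio (Int.fract s + n)) atTop (nhds 1) := by
    intro n
    induction n using Int.induction_on with
    | zero =>
      simpa using tendsto_gammaShiftRatio_of_mem_Ico (Int.fract_nonneg s) (Int.fract_lt_one s)
    | succ n ih =>
      rw [← tendsto_gammaShiftRatio_add_one_iff] at ih
      convert ih using 2
      push_cast
      ring
    | pred n ih =>
      rw [← tendsto_gammaShiftRatio_add_one_iff]
      convert ih using 2
      push_cast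
      ring
  simpa using key ⌊s⌋

theorem tendsto_kGamma (z : ℝ) :
    Tendsto (fun κ => kGamma κ z) (nhdsWithin 0 (Ioi 0)) (nhds (Real.Gamma z)) := by
  have hid : Tendsto (fun κ : ℝ => κ) (nhdsWithin 0 (Ioi 0)) (nhds 0) := nhdsWithin_le_nhds
  have ht : Tendsto (fun κ : ℝ => 1 / (2 * κ)) (nhdsWithin 0 (Ioi 0)) atTop := by
    have h := tendsto_inv_nhdsGT_zero (𝕜 := ℝ)
    refine (h.const_mul_atTop (by norm_num : (0 : ℝ) < 1 / 2)).congr fun κ => ?_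
    rw [one_div, one_div, mul_inv]
  have hlin : Tendsto (fun κ : ℝ => 1 - κ * (z - 1)) (nhdsWithin 0 (Ioi 0)) (nhds 1) := by
    simpa using (hid.mul_const (z - 1)).const_sub 1
  have hmain := (hlin.mul (((tendsto_gammaShiftRatio (-((z - 1) / 2))).comp ht).div
    ((tendsto_gammaShiftRatio ((z - 1) / 2)).comp ht) one_ne_zero)).mul_const (Real.Gamma z)
  rw [div_one, one_mul, one_mul] at hmain
  refine hmain.congr' ?_
  filter_upwards [self_mem_nhdsWithin, ht.eventually_gt_atTop 0] with κ hκ htκ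
  have hκ : 0 < κ := hκ
  have hpow : (2 * κ) ^ (z - 1) =
      ((1 / (2 * κ)) ^ ((z - 1) / 2) * (1 / (2 * κ)) ^ ((z - 1) / 2))⁻¹ := by
    rw [← Real.rpow_add htκ, add_halves, one_div, Real.inv_rpow (by positivity), inv_inv]
  rw [kGamma, hpow]
  simp only [Pi.div_apply, Function.comp_apply, gammaShiftRatio]
  rw [Real.rpow_neg htκ.le, ← sub_eq_add_neg]
  have hG := Real.Gamma_pos_of_pos htκ
  have hp := Real.rpow_pos_of_pos htκ ((z - 1) / 2)
  generalize 1 / (2 * κ) = t at *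
  generalize t ^ ((z - 1) / 2) = p at *
  field_simp

theorem kexp_eq_exp_arsinh (κ y : ℝ) : kexp κ y = Real.exp (Real.arsinh (κ * y) / κ) := by
  rw [kexp, ← mul_pow, add_comm, ← Real.exp_arsinh, ← Real.exp_mul, mul_one_div]

theorem tendsto_kexp (y : ℝ) :
    Tendsto (fun κ => kexp κ y) (nhdsWithin 0 (Ioi 0)) (nhds (Real.exp y)) := by
  simp only [kexp_eq_exp_arsinh]
  refine (Real.continuous_exp.tendsto y).comp ?_
  have h : HasDerivAt (fun κ : ℝ => Real.arsinh (κ * y)) y 0 := by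
    simpa using ((hasDerivAt_id (0 : ℝ)).mul_const y).arsinh
  simpa [div_eq_inv_mul] using h.tendsto_slope_zero_right

/-- In the limit κ → 0⁺ the κGG density reduces to the Generalized Gamma density. -/
theorem kGG_tendsto_generalized_gamma (α ν β : ℝ) (hα : 0 < α) (hν : 0 < ν) (hβ : 0 < β)
    (x : ℝ) (hx : 0 < x) :
    Filter.Tendsto (fun κ : ℝ => kGG α ν β κ x) (nhdsWithin 0 (Set.Ioi 0))
      (nhds ((ν/β) * (Real.Gamma (α/ν))⁻¹ * (x/β) ^ (α-1) * Real.exp (-((x/β) ^ ν)))) := by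
  have hid : Tendsto (fun κ : ℝ => κ) (nhdsWithin 0 (Ioi 0)) (nhds 0) := nhdsWithin_le_nhds
  have hnum : Tendsto (fun κ : ℝ => 1 - κ ^ 2 * (α / ν - 1) ^ 2) (nhdsWithin 0 (Ioi 0))
      (nhds 1) := by
    simpa using ((hid.pow 2).mul_const ((α / ν - 1) ^ 2)).const_sub 1
  have hden : Tendsto (fun κ : ℝ => Real.sqrt (1 + κ ^ 2 * (x / β) ^ (2 * ν)))
      (nhdsWithin 0 (Ioi 0)) (nhds 1) := by
    simpa using (((hid.pow 2).mul_const ((x / β) ^ (2 * ν))).const_add 1).sqrt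
  have hGamma := (tendsto_kGamma (α / ν)).inv₀ (Real.Gamma_pos_of_pos (div_pos hα hν)).ne'
  have h := (((((hnum.mul_const (ν / β)).mul hGamma).mul_const ((x / β) ^ (α - 1))).mul
    (tendsto_kexp (-((x / β) ^ ν)))).div hden one_ne_zero)
  rw [div_one, one_mul] at h
  exact h
end

section
/- Let κ ∈ (0,1). Then the κ-exponential has power-law asymptotic behaviour: lim_{x→+∞} exp_κ(x)/(2κx)^{1/κ} = 1 and lim_{x→+∞} exp_κ(−x)·(2κx)^{1/κ} = 1; i.e. exp_κ(±x) ∼ (2κx)^{±1/κ} as x → +∞. -/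
open Real MeasureTheory Filter Set

lemma sqrt_one_add_sq_add_pos (t : ℝ) : 0 < √(1 + t ^ 2) + t := by
  have h : |t| < √(1 + t ^ 2) := Real.lt_sqrt_of_sq_lt (by rw [sq_abs]; linarith)
  linarith [neg_abs_le t]

lemma kexp_neg_s18 (κ x : ℝ) : kexp κ (-x) = (kexp κ x)⁻¹ := by
  have hpos := sqrt_one_add_sq_add_pos (κ * x)
  have hs : √(1 + (κ * x) ^ 2) ^ 2 = 1 + (κ * x) ^ 2 := Real.sq_sqrt (by positivity)
  unfold kexp
  rw [neg_sq, mul_neg, ← mul_pow, ← Real.inv_rpow hpos.le]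
  congr 1
  refine eq_inv_of_mul_eq_one_left ?_
  linear_combination hs

lemma tendsto_sqrt_one_add_sq_add_div :
    Tendsto (fun t : ℝ => (√(1 + t ^ 2) + t) / (2 * t)) atTop (nhds 1) := by
  have hcont : Continuous fun u : ℝ => (√(1 + u ^ 2) + 1) / 2 := by fun_prop
  have hlim : Tendsto (fun t : ℝ => (√(1 + t⁻¹ ^ 2) + 1) / 2) atTop (nhds 1) := by
    have h := (hcont.tendsto 0).comp (tendsto_inv_atTop_zero (𝕜 := ℝ))
    norm_num at h
    simpa [Function.comp_def] using h
  refine hlim.congr' ?_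
  filter_upwards [eventually_gt_atTop 0] with t ht
  have h : √(1 + t ^ 2) = t * √(1 + t⁻¹ ^ 2) := by
    rw [Real.sqrt_eq_iff_mul_self_eq (by positivity) (by positivity), mul_mul_mul_comm,
      Real.mul_self_sqrt (by positivity)]
    field_simp
    ring
  rw [h]
  field_simp

/-- Power-law asymptotics of the κ-exponential: `exp_κ(±x) ∼ (2κx)^{±1/κ}` as `x → +∞`. -/
theorem kexp_asymptotics (κ : ℝ) (hκ : κ ∈ Set.Ioo (0:ℝ) 1) :
    Filter.Tendsto (fun x : ℝ => kexp κ x / (2*κ*x) ^ (1/κ)) Filter.atTop (nhds 1) ∧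
    Filter.Tendsto (fun x : ℝ => kexp κ (-x) * (2*κ*x) ^ (1/κ)) Filter.atTop (nhds 1) := by
  obtain ⟨hκ0, -⟩ := hκ
  have hpos : Tendsto (fun x : ℝ => kexp κ x / (2*κ*x) ^ (1/κ)) atTop (nhds 1) := by
    have h := (tendsto_sqrt_one_add_sq_add_div.comp
      (tendsto_id.const_mul_atTop hκ0)).rpow_const (p := 1/κ) (Or.inl one_ne_zero)
    rw [Real.one_rpow] at h
    refine h.congr' ?_
    filter_upwards [eventually_gt_atTop 0] with x hx
    have hp := sqrt_one_add_sq_add_pos (κ * x)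
    simp only [Function.comp_apply, id_eq, kexp]
    rw [Real.div_rpow hp.le (by positivity), mul_pow, mul_assoc 2 κ x]
  refine ⟨hpos, ?_⟩
  have hinv := hpos.inv₀ one_ne_zero
  rw [inv_one] at hinv
  refine hinv.congr fun x => ?_
  rw [kexp_neg_s18, inv_div, div_eq_mul_inv, mul_comm]
end
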